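/- arXiv:2010.05643 — 2 statements merged into one kernel-verified Lean document; each statement's English description precedes it below -/
import Mathlib

section
/- For every integer r ≥ 2 there exists a digraph G_r such that χ(G_r) = r and sm(G_r) ≤ r − 1, i.e. G_r has dichromatic number exactly r but contains no strong K⃗_r minor. -/
/-- A digraph on `V` is given by its adjacency relation `Adj` (loopless when
`Irreflexive Adj`).  `StronglyConnectedOn Adj S` says that the subdigraph of
the digraph induced by the vertex set `S` is strongly connected: for every
ordered pair of vertices of `S` there is a directed path inside `S` between
them. -/
def StronglyConnectedOn {V : Type} (Adj : V → V → Prop) (S : Set V) : Prop :=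
  ∀ ⦃u⦄, u ∈ S → ∀ ⦃v⦄, v ∈ S →
    Relation.ReflTransGen (fun a b => a ∈ S ∧ b ∈ S ∧ Adj a b) u v

/-- `S` is acyclic: the subdigraph induced by `S` contains no directed cycle. -/
def AcyclicOn {V : Type} (Adj : V → V → Prop) (S : Set V) : Prop :=
  ∀ v ∈ S, ¬ Relation.TransGen (fun a b => a ∈ S ∧ b ∈ S ∧ Adj a b) v v

/-- The subdigraph induced by `S` admits a partition of its vertex set into
`k` acyclic sets (a `k`-colouring). -/
def DiColorableOn {V : Type} (Adj : V → V → Prop) (S : Set V) (k : ℕ) : Prop :=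
  ∃ c : V → ℕ, (∀ v ∈ S, c v < k) ∧ ∀ i : ℕ, AcyclicOn Adj {v ∈ S | c v = i}

/-- The dichromatic number of the subdigraph induced by `S`: the least `k`
for which a `k`-colouring exists.  The dichromatic number of the whole
digraph is `dichromaticNumberOn Adj Set.univ`. -/
noncomputable def dichromaticNumberOn {V : Type} (Adj : V → V → Prop) (S : Set V) : ℕ :=
  sInf {k | DiColorableOn Adj S k}

/-- A tournament: a loopless digraph with exactly one directed edge between
any two distinct vertices. -/
def IsTournament {V : Type} (Adj : V → V → Prop) : Prop :=
  Irreflexive Adj ∧ ∀ u v : V, u ≠ v → (Adj u v ↔ ¬ Adj v u)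

/-- The digraph contains a strong `K⃗ r` minor: there are `r` pairwise
disjoint nonempty branch sets, each inducing a strongly connected
subdigraph, with at least one edge in each direction between any two
distinct branch sets. -/
def ContainsStrongCompleteMinor {V : Type} (Adj : V → V → Prop) (r : ℕ) : Prop :=
  ∃ X : Fin r → Set V,
    (∀ i, (X i).Nonempty) ∧
    (∀ i j, i ≠ j → Disjoint (X i) (X j)) ∧
    (∀ i, StronglyConnectedOn Adj (X i)) ∧
    (∀ i j, i ≠ j → ∃ u ∈ X i, ∃ v ∈ X j, Adj u v)

/-- Out-degree of a vertex. -/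
noncomputable def outDeg {V : Type} (Adj : V → V → Prop) (v : V) : ℕ :=
  {w | Adj v w}.ncard

/-- In-degree of a vertex. -/
noncomputable def inDeg {V : Type} (Adj : V → V → Prop) (v : V) : ℕ :=
  {w | Adj w v}.ncard

/-- The subdigraph induced by `W` is `k`-strongly-connected: it has at least
`k + 1` vertices and remains strongly connected after deleting any set of at
most `k - 1` vertices. -/
def KStronglyConnectedOn {V : Type} (Adj : V → V → Prop) (W : Set V) (k : ℕ) : Prop :=
  k + 1 ≤ W.ncard ∧
  ∀ S : Set V, S ⊆ W → S.ncard ≤ k - 1 → StronglyConnectedOn Adj (W \ S)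

/-- A directed triangle on `0, 1, 2`, every further vertex joined to all others in both
directions. -/
def triAdj (n : ℕ) (a b : Fin n) : Prop :=
  a ≠ b ∧ (3 ≤ a.val ∨ 3 ≤ b.val ∨ (a.val = 0 ∧ b.val = 1) ∨ (a.val = 1 ∧ b.val = 2) ∨
    (a.val = 2 ∧ b.val = 0))

theorem triAdj_colorable (r : ℕ) (hr : 2 ≤ r) :
    DiColorableOn (triAdj (r + 1)) Set.univ r := by
  refine ⟨fun v => v.val - 1, fun v _ => ?_, ?_⟩
  · have := v.isLt
    show v.val - 1 < r
    omega
  · intro i v _ h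
    have key : ∀ a b : Fin (r + 1), Relation.TransGen (fun a b : Fin (r + 1) =>
        a ∈ {v : Fin (r + 1) | v ∈ Set.univ ∧ v.val - 1 = i} ∧
        b ∈ {v : Fin (r + 1) | v ∈ Set.univ ∧ v.val - 1 = i} ∧ triAdj (r + 1) a b) a b →
        a.val < b.val := by
      have step : ∀ a b : Fin (r + 1), 
        (a ∈ {v : Fin (r + 1) | v ∈ Set.univ ∧ v.val - 1 = i} ∧
        b ∈ {v : Fin (r + 1) | v ∈ Set.univ ∧ v.val - 1 = i} ∧ triAdj (r + 1) a b) →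
        a.val < b.val := by
        rintro a b ⟨⟨_, ha⟩, ⟨_, hb⟩, hne, hab⟩
        have : a.val ≠ b.val := fun h => hne (Fin.ext h)
        omega
      intro a b hab
      induction hab with
      | single h => exact step _ _ h
      | tail _ h ih => exact lt_trans ih (step _ _ h)
    exact lt_irrefl _ (key v v h)

theorem triAdj_lower (r : ℕ) (hr : 2 ≤ r) (k : ℕ)
    (h : DiColorableOn (triAdj (r + 1)) Set.univ k) : r ≤ k := by
  obtain ⟨c, hc, hac⟩ := h
  have h2 : ∀ a b : Fin (r + 1), a ≠ b → 3 ≤ b.val → c a ≠ c b := by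
    intro a b hne hb hcab
    refine hac (c a) a ⟨trivial, rfl⟩ ?_
    refine Relation.TransGen.tail (b := b) (Relation.TransGen.single ?_) ?_
    · exact ⟨⟨trivial, rfl⟩, ⟨trivial, hcab.symm⟩, hne, Or.inr (Or.inl hb)⟩
    · exact ⟨⟨trivial, hcab.symm⟩, ⟨trivial, rfl⟩, hne.symm, Or.inl hb⟩
  let v0 : Fin (r + 1) := ⟨0, by omega⟩
  let v1 : Fin (r + 1) := ⟨1, by omega⟩
  let v2 : Fin (r + 1) := ⟨2, by omega⟩
  have h3 : ¬ (c v0 = c v1 ∧ c v0 = c v2) := by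
    rintro ⟨e1, e2⟩
    refine hac (c v0) v0 ⟨trivial, rfl⟩ ?_
    refine Relation.TransGen.tail (b := v2) (Relation.TransGen.tail (b := v1)
      (Relation.TransGen.single ?_) ?_) ?_
    · exact ⟨⟨trivial, rfl⟩, ⟨trivial, e1.symm⟩, by simp [triAdj, v0, v1]⟩
    · exact ⟨⟨trivial, e1.symm⟩, ⟨trivial, e2.symm⟩, by simp [triAdj, v1, v2]⟩
    · exact ⟨⟨trivial, e2.symm⟩, ⟨trivial, rfl⟩, by simp [triAdj, v0, v2]⟩
  -- a vertex of the triangle whose removal leaves an injective colouring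
  have h4 : ∃ m : Fin (r + 1), ∀ a b : Fin (r + 1), a ≠ m → b ≠ m → a.val < b.val →
      c a ≠ c b := by
    have tri : ∀ a : Fin (r + 1), a = v0 ∨ a = v1 ∨ a = v2 ∨ 3 ≤ a.val := by
      intro a
      simp only [Fin.ext_iff, v0, v1, v2]
      omega
    have main : ∀ m p q : Fin (r + 1), (∀ a : Fin (r + 1), a = m ∨ a = p ∨ a = q ∨ 3 ≤ a.val) →
        c p ≠ c q → ∀ a b : Fin (r + 1), a ≠ m → b ≠ m → a.val < b.val → c a ≠ c b := by
      intro m p q hall hpq a b ha hb hab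
      have hne : a ≠ b := fun h => by simp [h] at hab
      by_cases hb3 : 3 ≤ b.val
      · exact h2 a b hne hb3
      · have := hall a
        have := hall b
        have : ¬ 3 ≤ a.val := by omega
        grind
    by_cases e1 : c v0 = c v1
    · exact ⟨v1, main v1 v0 v2 (by grind) (by grind)⟩
    · exact ⟨v2, main v2 v0 v1 (by grind) e1⟩
  obtain ⟨m, hm⟩ := h4
  have hcard : (Finset.univ.erase m).card ≤ (Finset.range k).card := by
    refine Finset.card_le_card_of_injOn c (fun a _ => ?_) ?_
    · simpa using hc a trivial
    · intro a ha b hb hab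
      have ha' : a ≠ m := by simpa using ha
      have hb' : b ≠ m := by simpa using hb
      rcases lt_trichotomy a.val b.val with h | h | h
      · exact absurd hab (hm a b ha' hb' h)
      · exact Fin.ext h
      · exact absurd hab.symm (hm b a hb' ha' h)
  simpa using hcard

theorem strong_step {V : Type} {Adj : V → V → Prop} {S : Set V}
    (h : StronglyConnectedOn Adj S) {u v : V} (hu : u ∈ S) (hv : v ∈ S) (hne : u ≠ v) :
    ∃ w ∈ S, Adj u w := by
  rcases Relation.ReflTransGen.cases_head (h hu hv) with h | ⟨w, ⟨_, hw, ha⟩, _⟩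
  · exact absurd h hne
  · exact ⟨w, hw, ha⟩

theorem triAdj_no_minor (r : ℕ) (hr : 2 ≤ r) :
    ¬ ContainsStrongCompleteMinor (triAdj (r + 1)) r := by
  rintro ⟨X, hne, hdisj, hsc, hadj⟩
  have hf : ∀ i, ∃ x ∈ X i, x.val < 3 → ∀ y ∈ X i, y.val < 3 := by
    intro i
    by_cases h : ∃ x ∈ X i, 3 ≤ x.val
    · obtain ⟨x, hx, h3⟩ := h
      exact ⟨x, hx, fun h => by omega⟩
    · push Not at h
      obtain ⟨x, hx⟩ := hne i
      exact ⟨x, hx, fun _ => h⟩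
  choose f hfX hf3 using hf
  have hinj : ∀ i j, (f i).val = (f j).val → i = j := by
    intro i j hij
    by_contra hc
    have := Fin.ext hij
    exact Set.disjoint_left.mp (hdisj i j hc) (hfX i) (this ▸ hfX j)
  have hB : (Finset.univ.filter (fun i => ¬ (f i).val < 3)).card ≤ (Finset.Icc 3 r).card := by
    refine Finset.card_le_card_of_injOn (fun i => (f i).val) (fun i hi => ?_) ?_
    · have := (f i).isLt
      simp at hi ⊢
      omega
    · intro i _ j _ hij
      exact hinj i j hij
  have hsum := Finset.card_filter_add_card_filter_not (s := (Finset.univ : Finset (Fin r)))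
    (fun i => (f i).val < 3)
  simp only [Nat.card_Icc, Finset.card_univ, Fintype.card_fin] at hB hsum
  have hA : 1 < (Finset.univ.filter (fun i => (f i).val < 3)).card := by omega
  obtain ⟨i, hi, j, hj, hij⟩ := Finset.one_lt_card.mp hA
  simp only [Finset.mem_filter, Finset.mem_univ, true_and] at hi hj
  have hXi := hf3 i hi
  have hXj := hf3 j hj
  let v0 : Fin (r + 1) := ⟨0, by omega⟩
  let v1 : Fin (r + 1) := ⟨1, by omega⟩
  let v2 : Fin (r + 1) := ⟨2, by omega⟩
  have adj3 : ∀ a b : Fin (r + 1), a.val < 3 → b.val < 3 → triAdj (r + 1) a b →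
      (a = v0 ∧ b = v1) ∨ (a = v1 ∧ b = v2) ∨ (a = v2 ∧ b = v0) := by
    rintro a b ha hb ⟨_, h⟩
    simp only [Fin.ext_iff, v0, v1, v2]
    omega
  have n01 : v0 ≠ v1 := by simp [v0, v1]
  have n02 : v0 ≠ v2 := by simp [v0, v2]
  have n12 : v1 ≠ v2 := by simp [v1, v2]
  have st : ∀ l, (∀ y ∈ X l, y.val < 3) → ∀ u ∈ X l, ∀ v ∈ X l, u ≠ v →
      (u = v0 → v1 ∈ X l) ∧ (u = v1 → v2 ∈ X l) ∧ (u = v2 → v0 ∈ X l) := by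
    intro l hl u hu v hv huv
    obtain ⟨w, hw, haw⟩ := strong_step (hsc l) hu hv huv
    have := adj3 u w (hl u hu) (hl w hw) haw
    grind
  have dis : ∀ x, x ∈ X i → x ∈ X j → False := fun x h1 h2 =>
    Set.disjoint_left.mp (hdisj i j hij) h1 h2
  obtain ⟨u, hu, v, hv, huv⟩ := hadj i j hij
  obtain ⟨v', hv', u', hu', hvu⟩ := hadj j i hij.symm
  have e1 := adj3 u v (hXi u hu) (hXj v hv) huv
  have e2 := adj3 v' u' (hXj v' hv') (hXi u' hu') hvu
  have s1 := st i hXi u hu u' hu'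
  have s2 := st j hXj v' hv' v hv
  have d1 := dis v0
  have d2 := dis v1
  have d3 := dis v2
  clear st dis adj3 hadj hdisj hsc
  clear_value v0 v1 v2
  grind


/-- for every `r ≥ 2` there is a digraph with dichromatic
number exactly `r` containing no strong `K⃗ r` minor. -/
theorem exists_digraph_chi_eq_r_no_strong_minor (r : ℕ) (hr : 2 ≤ r) :
    ∃ (n : ℕ) (Adj : Fin n → Fin n → Prop),
      Irreflexive Adj ∧
      dichromaticNumberOn Adj Set.univ = r ∧
      ¬ ContainsStrongCompleteMinor Adj r := by
  refine ⟨r + 1, triAdj (r + 1), fun a h => h.1 rfl, ?_, triAdj_no_minor r hr⟩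
  refine le_antisymm (Nat.sInf_le (triAdj_colorable r hr)) ?_
  exact triAdj_lower r hr _ (Nat.sInf_mem (s := {k | DiColorableOn (triAdj (r + 1)) Set.univ k})
    ⟨r, triAdj_colorable r hr⟩)
end

section
/- For every integer k ≥ 1 there exists a digraph D_k whose minimum out-degree is at least k and which contains no strong K⃗_3 minor, i.e. sm(D_k) ≤ 2. -/
/-- Adjacency in the tree of lists: each list points to its extensions by one letter, and
lists of full length `k` point to all their proper suffixes. -/
def TreeAdj (k : ℕ) (l m : List (Fin k)) : Prop :=
  (∃ a, m = a :: l) ∨ (l.length = k ∧ m ≠ l ∧ m <:+ l)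

theorem treeAdj_enter {k : ℕ} {u w x : List (Fin k)} (h : TreeAdj k u w) (hx : x <:+ w)
    (hne : w ≠ x) : x <:+ u := by
  rcases h with ⟨a, rfl⟩ | ⟨_, _, h⟩
  · rcases List.suffix_cons_iff.1 hx with h | h
    · exact absurd h.symm hne
    · exact h
  · exact hx.trans h

theorem strong_top {k : ℕ} {V : Type} (f : V → List (Fin k)) (S : Set V) (hS : S.Nonempty)
    (hc : StronglyConnectedOn (fun a b => TreeAdj k (f a) (f b)) S) :
    ∃ t ∈ S, ∀ w ∈ S, f t <:+ f w := by
  classical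
  obtain ⟨t, ht, hmin⟩ := exists_minimalFor_of_wellFoundedLT (fun v => v ∈ S)
    (fun v => (f v).length) hS
  refine ⟨t, ht, fun w hw => ?_⟩
  have hp := hc ht hw
  clear hw
  induction hp with
  | refl => exact List.suffix_rfl
  | @tail b c _ hs ih =>
    obtain ⟨_, hcS, h⟩ := hs
    rcases h with ⟨a, ha⟩ | ⟨_, _, h⟩
    · rw [ha]
      exact ih.trans (List.suffix_cons _ _)
    · refine List.suffix_of_suffix_length_le ih h ?_
      rcases le_total (f t).length (f c).length with h' | h'
      · exact h'
      · exact hmin hcS h'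

theorem no_three {k : ℕ} {V : Type} (f : V → List (Fin k)) (hf : Function.Injective f) :
    ¬ ContainsStrongCompleteMinor (fun a b => TreeAdj k (f a) (f b)) 3 := by
  rintro ⟨X, hne, hdis, hstr, hadj⟩
  choose t htX ht using fun i => strong_top f (X i) (hne i) (hstr i)
  have comp : ∀ i j, i ≠ j → (f (t i)).length ≤ (f (t j)).length → f (t i) <:+ f (t j) := by
    intro i j hij hl
    obtain ⟨u, hu, w, hw, h⟩ := hadj i j hij
    have h1 := ht i u hu
    have h2 := ht j w hw
    rcases h with ⟨a, ha⟩ | ⟨_, _, h⟩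
    · have h3 : f u <:+ f w := by rw [ha]; exact List.suffix_cons _ _
      exact List.suffix_of_suffix_length_le (h1.trans h3) h2 hl
    · exact List.suffix_of_suffix_length_le h1 (h2.trans h) hl
  have key : ∀ a b c, a ≠ b → b ≠ c → a ≠ c → (f (t a)).length ≤ (f (t b)).length →
      (f (t b)).length ≤ (f (t c)).length → False := by
    intro a b c hab hbc hac h1 h2
    have sab := comp a b hab h1
    have sbc := comp b c hbc h2
    have notin : ∀ i, i ≠ b → ∀ v ∈ X i, f v ≠ f (t b) := by
      intro i hi v hv he
      have := hf he
      subst this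
      exact Set.disjoint_left.1 (hdis i b hi) hv (htX b)
    obtain ⟨u, hu, w, hw, h⟩ := hadj a c hac
    have hbu : f (t b) <:+ f u :=
      treeAdj_enter h (sbc.trans (ht c w hw)) (notin c hbc.symm w hw)
    have hp := hstr a (htX a) hu
    have hba : f (t b) <:+ f (t a) := by
      clear hu h
      induction hp with
      | refl => exact hbu
      | tail _ hs ih => exact ih (treeAdj_enter hs.2.2 hbu (notin a hab _ hs.2.1))
    exact notin a hab _ (htX a) (sab.eq_of_length_le hba.length_le)
  have k1 := key 0 1 2 (by decide) (by decide) (by decide)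
  have k2 := key 0 2 1 (by decide) (by decide) (by decide)
  have k3 := key 1 0 2 (by decide) (by decide) (by decide)
  have k4 := key 1 2 0 (by decide) (by decide) (by decide)
  have k5 := key 2 0 1 (by decide) (by decide) (by decide)
  have k6 := key 2 1 0 (by decide) (by decide) (by decide)
  rcases le_total (f (t 0)).length (f (t 1)).length with h | h <;>
  rcases le_total (f (t 1)).length (f (t 2)).length with h' | h' <;>
  rcases le_total (f (t 0)).length (f (t 2)).length with h'' | h'' <;>
  first
    | exact k1 (by omega) (by omega)
    | exact k2 (by omega) (by omega)
    | exact k3 (by omega) (by omega)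
    | exact k4 (by omega) (by omega)
    | exact k5 (by omega) (by omega)
    | exact k6 (by omega) (by omega)

/-- for every `k ≥ 1` there is a digraph with minimum
out-degree at least `k` containing no strong `K⃗ 3` minor. -/
theorem exists_digraph_large_outdegree_no_strong_K3_minor (k : ℕ) (hk : 1 ≤ k) :
    ∃ (n : ℕ) (Adj : Fin n → Fin n → Prop),
      0 < n ∧ Irreflexive Adj ∧
      (∀ v : Fin n, k ≤ outDeg Adj v) ∧
      ¬ ContainsStrongCompleteMinor Adj 3 := by
  have hfin : Finite {l : List (Fin k) | l.length ≤ k} := List.finite_length_le (Fin k) k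
  obtain ⟨n, ⟨e⟩⟩ := Finite.exists_equiv_fin {l : List (Fin k) | l.length ≤ k}
  set f : Fin n → List (Fin k) := fun i => (e.symm i).1 with hfd
  have hf : Function.Injective f := Subtype.val_injective.comp e.symm.injective
  have hlen : ∀ i, (f i).length ≤ k := fun i => (e.symm i).2
  have hsurj : ∀ l : List (Fin k), l.length ≤ k → ∃ i, f i = l := fun l hl =>
    ⟨e ⟨l, hl⟩, by simp [hfd]⟩
  refine ⟨n, fun a b => TreeAdj k (f a) (f b), ?_, ?_, ?_, no_three f hf⟩
  · exact Fin.pos (e ⟨[], by simp⟩)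
  · rintro a (⟨c, hc⟩ | ⟨_, h, _⟩)
    · simpa using congrArg List.length hc
    · exact h rfl
  · intro v
    have main : ∃ g : Fin k → List (Fin k), Function.Injective g ∧
        ∀ i, (g i).length ≤ k ∧ TreeAdj k (f v) (g i) := by
      rcases (hlen v).lt_or_eq with h | h
      · refine ⟨fun i => i :: f v, fun i j hij => by simpa using hij, fun i => ⟨?_, ?_⟩⟩
        · simpa using h
        · exact Or.inl ⟨i, rfl⟩
      · refine ⟨fun i => (f v).drop (i + 1), fun i j hij => ?_, fun i => ⟨?_, ?_⟩⟩
        · have := congrArg List.length hij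
          simp only [List.length_drop] at this
          ext
          omega
        · simp only [List.length_drop]; omega
        · refine Or.inr ⟨h, fun he => ?_, List.drop_suffix _ _⟩
          have := congrArg List.length he
          simp only [List.length_drop] at this
          omega
    obtain ⟨g, hg, hga⟩ := main
    choose r hr using fun i => hsurj (g i) (hga i).1
    have hrinj : Function.Injective r := fun i j hij => hg (by rw [← hr i, ← hr j, hij])
    have hsub : Set.range r ⊆ {w | TreeAdj k (f v) (f w)} := by
      rintro _ ⟨i, rfl⟩
      simp only [Set.mem_setOf_eq, hr]
      exact (hga i).2
    have := Set.ncard_le_ncard hsub (Set.toFinite _)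
    rw [← Set.image_univ, Set.ncard_image_of_injective _ hrinj, Set.ncard_univ] at this
    simpa [outDeg] using this
end
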